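/- arXiv:2502.01505 — 3 statements merged into one kernel-verified Lean document; each statement's English description precedes it below -/
import Mathlib

section
/- Let z : N → M be a 1-cocycle on N. Then the transfer cor_s(z) : G → M is a 1-cocycle on G, i.e. cor_s(z)(w₁w₂) = cor_s(z)(w₁) + w₁ • cor_s(z)(w₂) for all w₁, w₂ ∈ G. -/
open scoped BigOperators

variable {G : Type*} [Group G] {M : Type*} [AddCommGroup M] [DistribMulAction G M]

/-- A 1-cocycle on a subgroup `H` of `G` (for the restricted action). -/
def IsCocycleOn (H : Subgroup G) (z : H → M) : Prop :=
  ∀ h₁ h₂ : H, z (h₁ * h₂) = z h₁ + (h₁ : G) • z h₂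

/-- A 1-cocycle on `G`. -/
def IsCocycle (z : G → M) : Prop :=
  ∀ w₁ w₂ : G, z (w₁ * w₂) = z w₁ + w₁ • z w₂

/-- The element `s(γ)⁻¹ ⬝ w ⬝ s(w⁻¹γ)` lies in the normal subgroup `N`,
provided `s` is a section of the projection `G → G ⧸ N`. -/
lemma transfer_arg_mem (N : Subgroup G) [N.Normal] {s : G ⧸ N → G}
    (hs : ∀ γ : G ⧸ N, (QuotientGroup.mk (s γ) : G ⧸ N) = γ) (w : G) (γ : G ⧸ N) :
    (s γ)⁻¹ * w * s ((QuotientGroup.mk w : G ⧸ N)⁻¹ * γ) ∈ N := by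
  rw [← QuotientGroup.eq_one_iff]
  simp only [QuotientGroup.mk_mul, QuotientGroup.mk_inv,
    hs γ, hs ((QuotientGroup.mk w : G ⧸ N)⁻¹ * γ)]
  group

/-- The transfer (corestriction) `cor_s(z) : G → M` of a function `z : N → M`
along a section `s : G ⧸ N → G`, where `N` is a normal subgroup of finite index. -/
def transfer (N : Subgroup G) [N.Normal] [Fintype (G ⧸ N)] (s : G ⧸ N → G)
    (hs : ∀ γ : G ⧸ N, (QuotientGroup.mk (s γ) : G ⧸ N) = γ) (z : N → M) : G → M :=
  fun w => ∑ γ : G ⧸ N,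
    s γ • z ⟨(s γ)⁻¹ * w * s ((QuotientGroup.mk w : G ⧸ N)⁻¹ * γ),
      transfer_arg_mem N hs w γ⟩

/-- the transfer of a 1-cocycle on `N` is a 1-cocycle on `G`. -/
theorem transfer_isCocycle (N : Subgroup G) [N.Normal] [Fintype (G ⧸ N)]
    (s : G ⧸ N → G) (hs : ∀ γ : G ⧸ N, (QuotientGroup.mk (s γ) : G ⧸ N) = γ)
    (z : N → M) (hz : IsCocycleOn N z) :
    ∀ w₁ w₂ : G, transfer N s hs z (w₁ * w₂) =
      transfer N s hs z w₁ + w₁ • transfer N s hs z w₂ := by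
  intro w₁ w₂
  unfold transfer
  rw [Finset.smul_sum,
    ← Equiv.sum_comp (Equiv.mulLeft (QuotientGroup.mk w₁ : G ⧸ N)⁻¹) (fun γ => w₁ • s γ • z _),
    ← Finset.sum_add_distrib]
  refine Finset.sum_congr rfl fun γ _ => ?_
  have hmul : (⟨_, transfer_arg_mem N hs (w₁ * w₂) γ⟩ : N) =
      ⟨_, transfer_arg_mem N hs w₁ γ⟩ *
        ⟨_, transfer_arg_mem N hs w₂ ((QuotientGroup.mk w₁ : G ⧸ N)⁻¹ * γ)⟩ := by
    ext
    simp only [Subgroup.coe_mul, QuotientGroup.mk_mul, mul_inv_rev, mul_assoc,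
      mul_inv_cancel_left]
  rw [hmul, hz, smul_add, smul_smul, smul_smul]
  simp only [Equiv.coe_mulLeft, mul_assoc, mul_inv_cancel_left]
end

section
/- For any two sections s, s′ : G/N → G of the projection onto the left coset space and any 1-cocycle z : N → M, the transfers cor_s(z) and cor_{s′}(z) are cohomologous 1-cocycles on G, i.e. their difference is a 1-coboundary on G. -/
open scoped BigOperators

variable {G : Type*} [Group G] {M : Type*} [AddCommGroup M] [DistribMulAction G M]

/-- A 1-coboundary on `G`. -/
def IsCoboundary (z : G → M) : Prop :=
  ∃ m : M, ∀ w : G, z w = w • m - m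

/-- Two sections of the projection `G → G ⧸ N` differ by elements of `N`. -/
lemma section_inv_mul_mem (N : Subgroup G) [N.Normal] {s s' : G ⧸ N → G}
    (hs : ∀ γ : G ⧸ N, (QuotientGroup.mk (s γ) : G ⧸ N) = γ)
    (hs' : ∀ γ : G ⧸ N, (QuotientGroup.mk (s' γ) : G ⧸ N) = γ) (γ : G ⧸ N) :
    (s γ)⁻¹ * s' γ ∈ N :=
  QuotientGroup.eq.mp ((hs γ).trans (hs' γ).symm)

/-- If `n * a' = a * n'` in `H`, the values of a cocycle at `a` and `a'` differ by those at
`n` and `n'`. -/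
lemma IsCocycleOn.add_smul_eq {H : Subgroup G} {z : H → M} (hz : IsCocycleOn H z)
    {n a' a n' : H} (h : n * a' = a * n') :
    z n + (n : G) • z a' = z a + (a : G) • z n' := by
  rw [← hz, ← hz, h]

/-- for two sections `s, s'` and a 1-cocycle `z` on `N`, the transfers
`cor_s(z)` and `cor_{s'}(z)` are cohomologous 1-cocycles on `G`: their difference is
a 1-coboundary on `G`. -/
theorem transfer_section_independent (N : Subgroup G) [N.Normal] [Fintype (G ⧸ N)]
    (s s' : G ⧸ N → G)
    (hs : ∀ γ : G ⧸ N, (QuotientGroup.mk (s γ) : G ⧸ N) = γ)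
    (hs' : ∀ γ : G ⧸ N, (QuotientGroup.mk (s' γ) : G ⧸ N) = γ)
    (z : N → M) (hz : IsCocycleOn N z) :
    IsCoboundary (fun w => transfer N s hs z w - transfer N s' hs' z w) := by
  let n : G ⧸ N → N := fun γ => ⟨(s γ)⁻¹ * s' γ, section_inv_mul_mem N hs hs' γ⟩
  refine ⟨-∑ γ, s γ • z (n γ), fun w => ?_⟩
  have reindex : ∑ γ, s γ • z (n γ) =
      ∑ γ, s ((QuotientGroup.mk w : G ⧸ N)⁻¹ * γ) •
        z (n ((QuotientGroup.mk w : G ⧸ N)⁻¹ * γ)) :=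
    (Equiv.sum_comp (Equiv.mulLeft (QuotientGroup.mk w : G ⧸ N)⁻¹) fun γ => s γ • z (n γ)).symm
  have key : transfer N s' hs' z w + ∑ γ, s γ • z (n γ) =
      transfer N s hs z w + w • ∑ γ, s γ • z (n γ) := by
    nth_rewrite 2 [reindex]
    simp only [transfer, Finset.smul_sum, ← Finset.sum_add_distrib]
    refine Finset.sum_congr rfl fun γ _ => ?_
    have h := congrArg (s γ • ·) (hz.add_smul_eq
      (n := n γ) (n' := n ((QuotientGroup.mk w : G ⧸ N)⁻¹ * γ))
      (a := ⟨_, transfer_arg_mem N hs w γ⟩) (a' := ⟨_, transfer_arg_mem N hs' w γ⟩)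
      (Subtype.ext (by simp only [n, Subgroup.coe_mul]; group)))
    simp only [smul_add, smul_smul] at h ⊢
    rw [add_comm]
    convert h using 3
    · simp [n]
    · group
  rw [smul_neg, sub_neg_eq_add, sub_eq_iff_eq_add, eq_comm, neg_add_eq_sub, sub_add_eq_add_sub,
    sub_eq_iff_eq_add, add_comm, key]
end

section
/- Let z : N → M be a 1-cocycle on N. Then the averaged function A_t(z) : N → M is again a 1-cocycle on N, i.e. A_t(z)(n₁n₂) = A_t(z)(n₁) + n₁ • A_t(z)(n₂) for all n₁, n₂ ∈ N. -/
open scoped BigOperators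

variable {G : Type*} [Group G] {M : Type*} [AddCommGroup M] [DistribMulAction G M]

/-- The averaged function `A_t(z) : N → M` of `z : N → M`, relative to a section
`t : G ⧸ E → G` of the projection onto the left coset space `G ⧸ E`. -/
def averaged (N E : Subgroup G) [hN : N.Normal] [Fintype (G ⧸ E)]
    (t : G ⧸ E → G) (z : N → M) : N → M :=
  fun n => ∑ γ : G ⧸ E, t γ • z ⟨(t γ)⁻¹ * (n : G) * t γ, hN.conj_mem' (n : G) n.2 (t γ)⟩

/-- the averaged function of a 1-cocycle on `N` is again a
1-cocycle on `N`. Here `N` is a normal subgroup of `G`, `E` is a subgroup with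
`N ≤ E ≤ G` of finite index in `G`, and `t : G ⧸ E → G` is a section of the
projection onto the left coset space. -/
theorem averaged_isCocycle (N E : Subgroup G) [N.Normal] [Fintype (G ⧸ E)]
    (hNE : N ≤ E)
    (t : G ⧸ E → G) (ht : ∀ γ : G ⧸ E, (QuotientGroup.mk (t γ) : G ⧸ E) = γ)
    (z : N → M) (hz : IsCocycleOn N z) :
    ∀ n₁ n₂ : N, averaged N E t z (n₁ * n₂) =
      averaged N E t z n₁ + (n₁ : G) • averaged N E t z n₂ := by
  intro n₁ n₂
  simp only [averaged]
  rw [Finset.smul_sum, ← Finset.sum_add_distrib]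
  refine Finset.sum_congr rfl fun γ _ => ?_
  have hconj : ∀ n : N, (t γ)⁻¹ * (n : G) * t γ ∈ N :=
    fun n => Subgroup.Normal.conj_mem' inferInstance (n : G) n.2 (t γ)
  have hmul : (⟨(t γ)⁻¹ * ((n₁ * n₂ : N) : G) * t γ, hconj (n₁ * n₂)⟩ : N) =
      ⟨(t γ)⁻¹ * (n₁ : G) * t γ, hconj n₁⟩ * ⟨(t γ)⁻¹ * (n₂ : G) * t γ, hconj n₂⟩ := by
    ext
    simp [mul_assoc]
  rw [hmul, hz, smul_add, smul_smul, smul_smul]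
  congr 2
  group
end
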